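/- arXiv:1604.06204 — 7 statements merged into one kernel-verified Lean document; each statement's English description precedes it below -/
import Mathlib

section
/- Let (X, I₀, P, Inp, C, T) be a safety specification with T complete and deterministic, and assume Inp and C are nonempty. If F ⊆ X is a winning area (I₀ ⊆ F, F ⊆ P, and F ⊆ Force¹ₛ(F)), then there exists a system implementation f : X × Inp → C that realizes the specification: every play under f starting in I₀ visits only states of P (indeed, only states of F). -/
/-- If a safety specification (with complete and deterministic transition
relation, and nonempty input types) has a winning area `F` (i.e. `I₀ ⊆ F`,
`F ⊆ P`, and `F ⊆ Force¹ₛ(F)`), then there exists a system implementation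
`f : X × Inp → C` realizing the specification: every play under `f` starting
in `I₀` visits only states of `P` (indeed, only states of `F`). -/
theorem winning_area_implies_realizable
    {X Inp C : Type*} [Nonempty Inp] [Nonempty C]
    (I₀ P : Set X) (T : X → Inp → C → X → Prop)
    (hcomplete : ∀ x i c, ∃ x', T x i c x')
    (hdet : ∀ x i c x₁' x₂', T x i c x₁' → T x i c x₂' → x₁' = x₂')
    (F : Set X)
    (hIF : I₀ ⊆ F) (hFP : F ⊆ P)
    (hforce : F ⊆ {x | ∀ i, ∃ c, ∃ x', T x i c x' ∧ x' ∈ F}) :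
    ∃ f : X × Inp → C,
      ∀ x : ℕ → X,
        (∀ n, ∃ i, T (x n) i (f (x n, i)) (x (n + 1))) →
        x 0 ∈ I₀ →
        ∀ n, x n ∈ P ∧ x n ∈ F := by
  have hchoice : ∀ p : X × Inp, ∃ c, p.1 ∈ F → ∃ x', T p.1 p.2 c x' ∧ x' ∈ F := by
    rintro ⟨x, i⟩
    by_cases hx : x ∈ F
    · obtain ⟨c, hc⟩ := hforce hx i
      exact ⟨c, fun _ => hc⟩
    · exact ⟨Classical.arbitrary C, fun h => absurd h hx⟩
  choose f hf using hchoice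
  refine ⟨f, fun x hplay h0 => ?_⟩
  have hF : ∀ n, x n ∈ F := by
    intro n
    induction n with
    | zero => exact hIF h0
    | succ n ih =>
      obtain ⟨i, hi⟩ := hplay n
      obtain ⟨x', hT, hx'⟩ := hf (x n, i) ih
      exact hdet _ _ _ _ _ hT hi ▸ hx'
  exact fun n => ⟨hFP (hF n), hF n⟩
end

section
/- Let (X, I₀, P, Inp, C, T) be a safety specification with T complete, and assume Inp is nonempty. If some system implementation f : X × Inp → C realizes the specification, then a winning area exists: the set F of states reachable from I₀ by a finite play under f (i.e., states x_k for some finite sequence x₀,…,x_k with x₀ ∈ I₀ and, for each j < k, some input i with T(x_j, i, f(x_j,i), x_{j+1})) satisfies I₀ ⊆ F, F ⊆ P, and F ⊆ Force¹ₛ(F). -/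
/-- A finite path of a total relation extends to an infinite one. -/
theorem exists_path_extending {X : Type*} {r : X → X → Prop} (hr : ∀ x, ∃ y, r x y)
    {k : ℕ} {x : ℕ → X} (hx : ∀ j < k, r (x j) (x (j + 1))) :
    ∃ y : ℕ → X, (∀ j ≤ k, y j = x j) ∧ ∀ n, r (y n) (y (n + 1)) := by
  choose g hg using hr
  refine ⟨fun n => g^[n - k] (x (min n k)), fun j hj => by simp [hj], fun n => ?_⟩
  rcases lt_or_ge n k with h | h
  · simpa [h.le, Nat.sub_eq_zero_of_le h.le, Nat.sub_eq_zero_of_le (Nat.succ_le_of_lt h),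
      min_eq_left (Nat.succ_le_of_lt h)] using hx n h
  · simpa [min_eq_right h, min_eq_right (Nat.le_succ_of_le h), Nat.succ_sub h,
      Function.iterate_succ_apply'] using hg (g^[n - k] (x k))


/-- If a system implementation `f` realizes a safety specification (with
complete transition relation and nonempty input type), then the set `F` of
states reachable from `I₀` by a finite play under `f` is a winning area:
`I₀ ⊆ F`, `F ⊆ P`, and `F ⊆ Force¹ₛ(F)`. -/
theorem realizable_implies_winning_area
    {X Inp C : Type*} [Nonempty Inp]
    (I₀ P : Set X) (T : X → Inp → C → X → Prop)
    (hcomplete : ∀ x i c, ∃ x', T x i c x')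
    (f : X × Inp → C)
    (hrealizes : ∀ x : ℕ → X,
      (∀ n, ∃ i, T (x n) i (f (x n, i)) (x (n + 1))) →
      x 0 ∈ I₀ → ∀ n, x n ∈ P) :
    I₀ ⊆ {y | ∃ (k : ℕ) (x : ℕ → X), x 0 ∈ I₀ ∧
            (∀ j < k, ∃ i, T (x j) i (f (x j, i)) (x (j + 1))) ∧ x k = y} ∧
    {y | ∃ (k : ℕ) (x : ℕ → X), x 0 ∈ I₀ ∧
        (∀ j < k, ∃ i, T (x j) i (f (x j, i)) (x (j + 1))) ∧ x k = y} ⊆ P ∧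
    {y | ∃ (k : ℕ) (x : ℕ → X), x 0 ∈ I₀ ∧
        (∀ j < k, ∃ i, T (x j) i (f (x j, i)) (x (j + 1))) ∧ x k = y} ⊆
      {x | ∀ i, ∃ c, ∃ x', T x i c x' ∧
        x' ∈ {y | ∃ (k : ℕ) (x : ℕ → X), x 0 ∈ I₀ ∧
          (∀ j < k, ∃ i, T (x j) i (f (x j, i)) (x (j + 1))) ∧ x k = y}} := by
  refine ⟨fun y hy => ⟨0, fun _ => y, hy, by simp, rfl⟩, ?_, ?_⟩
  · rintro y ⟨k, x, h0, hx, rfl⟩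
    have htotal : ∀ x, ∃ y, ∃ i, T x i (f (x, i)) y := fun x =>
      let i := Classical.arbitrary Inp
      (hcomplete x i (f (x, i))).imp fun _ h => ⟨i, h⟩
    obtain ⟨z, hzx, hz⟩ := exists_path_extending htotal hx
    rw [← hzx k le_rfl]
    exact hrealizes z hz (by rwa [hzx 0 k.zero_le]) k
  · rintro y ⟨k, x, h0, hx, rfl⟩ i
    obtain ⟨x', hx'⟩ := hcomplete (x k) i (f (x k, i))
    refine ⟨f (x k, i), x', hx', k + 1, fun n => if n ≤ k then x n else x', by simpa using h0,
      fun j hj => ?_, by simp⟩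
    rcases (Nat.lt_succ_iff.mp hj).lt_or_eq with h | rfl
    · simpa [h.le, Nat.succ_le_of_lt h] using hx j h
    · simpa using ⟨i, hx'⟩
end

section
/- Let (X, I₀, P, Inp, C, T) be a safety specification with T complete and deterministic, and assume Inp and C are nonempty. Then the specification is realizable (there exists a system implementation f : X × Inp → C such that every play under f starting in I₀ visits only states of P) if and only if there exists a winning area, i.e., a set F ⊆ X with I₀ ⊆ F, F ⊆ P, and F ⊆ Force¹ₛ(F). -/
/-- A safety specification (with complete and deterministic transition relation
and nonempty input types) is realizable iff a winning area exists. -/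
theorem realizable_iff_winning_area_exists
    {X Inp C : Type*} [Nonempty Inp] [Nonempty C]
    (I₀ P : Set X) (T : X → Inp → C → X → Prop)
    (hcomplete : ∀ x i c, ∃ x', T x i c x')
    (hdet : ∀ x i c x₁' x₂', T x i c x₁' → T x i c x₂' → x₁' = x₂') :
    (∃ f : X × Inp → C,
        ∀ x : ℕ → X,
          (∀ n, ∃ i, T (x n) i (f (x n, i)) (x (n + 1))) →
          x 0 ∈ I₀ → ∀ n, x n ∈ P)
    ↔ (∃ F : Set X, I₀ ⊆ F ∧ F ⊆ P ∧
        F ⊆ {x | ∀ i, ∃ c, ∃ x', T x i c x' ∧ x' ∈ F}) := by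
  constructor
  · rintro ⟨f, hf⟩
    refine ⟨{y | ∀ x : ℕ → X, (∀ n, ∃ i, T (x n) i (f (x n, i)) (x (n + 1))) →
      x 0 = y → ∀ n, x n ∈ P}, ?_, ?_, ?_⟩
    · intro y hy x hx h0
      exact hf x hx (h0 ▸ hy)
    · intro y hy
      obtain ⟨i⟩ := ‹Nonempty Inp›
      choose next hnext using fun x => hcomplete x i (f (x, i))
      refine hy (fun n => next^[n] y) (fun n => ⟨i, ?_⟩) rfl 0
      simpa only [Function.iterate_succ_apply'] using hnext (next^[n] y)
    · intro y hy i
      obtain ⟨x', hx'⟩ := hcomplete y i (f (y, i))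
      refine ⟨f (y, i), x', hx', fun x hx h0 n => ?_⟩
      refine hy (fun n => Nat.casesOn n y x) (fun n => ?_) rfl (n + 1)
      cases n with
      | zero => exact ⟨i, show T y i (f (y, i)) (x 0) from h0.symm ▸ hx'⟩
      | succ n => exact hx n
  · rintro ⟨F, hI, hP, hF⟩
    have hchoice : ∀ p : X × Inp, ∃ c, p.1 ∈ F → ∃ x', T p.1 p.2 c x' ∧ x' ∈ F := by
      rintro ⟨x, i⟩
      by_cases hx : x ∈ F
      · obtain ⟨c, hc⟩ := hF hx i
        exact ⟨c, fun _ => hc⟩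
      · exact ⟨Classical.arbitrary C, fun h => absurd h hx⟩
    choose f hf using hchoice
    refine ⟨f, fun x hx h0 n => hP ?_⟩
    induction n with
    | zero => exact hI h0
    | succ n ih =>
      obtain ⟨i, hi⟩ := hx n
      obtain ⟨x', hT, hx'⟩ := hf (x n, i) ih
      exact hdet _ _ _ _ _ hT hi ▸ hx'
end

section
/- Let (X, I₀, P, Inp, C, T) be a safety specification with T deterministic. Let S ⊆ X × Inp × C × X be a relation with S(x,i,c,x') implying T(x,i,c,x'), and suppose S is winning: every sequence x : ℕ → X with x 0 ∈ I₀ such that for every n there exist i and c with S(x n, i, c, x(n+1)) satisfies x n ∈ P for all n. If a system implementation f : X × Inp → C implements S, i.e., for all x and i there exists x' with S(x, i, f(x,i), x'), then f realizes the specification: every play under f with x 0 ∈ I₀ satisfies x n ∈ P for all n. -/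
/-- If a system implementation `f` implements a winning strategy `S` (that
refines a deterministic transition relation `T`), then `f` realizes the
specification: every play under `f` starting in `I₀` visits only safe
states. -/
theorem implementation_of_winning_strategy_realizes
    {X Inp C : Type*}
    (I₀ P : Set X) (T : X → Inp → C → X → Prop)
    (hdet : ∀ x i c x₁' x₂', T x i c x₁' → T x i c x₂' → x₁' = x₂')
    (S : X → Inp → C → X → Prop)
    (hST : ∀ x i c x', S x i c x' → T x i c x')
    (hwin : ∀ x : ℕ → X, x 0 ∈ I₀ →
      (∀ n, ∃ (i : Inp) (c : C), S (x n) i c (x (n + 1))) →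
      ∀ n, x n ∈ P)
    (f : X × Inp → C)
    (himpl : ∀ x i, ∃ x', S x i (f (x, i)) x') :
    ∀ x : ℕ → X,
      (∀ n, ∃ i, T (x n) i (f (x n, i)) (x (n + 1))) →
      x 0 ∈ I₀ → ∀ n, x n ∈ P := by
  intro x hplay hinit
  refine hwin x hinit fun n => ?_
  obtain ⟨i, hT⟩ := hplay n
  obtain ⟨x', hS⟩ := himpl (x n) i
  obtain rfl := hdet _ _ _ _ _ (hST _ _ _ _ hS) hT
  exact ⟨i, _, hS⟩
end

section
/- Let T be a complete transition relation over states X, a nonempty type Inp of uncontrollable inputs, and controllable inputs C, and let P ⊆ X. Let W₀ ⊆ X be the set of winning states, i.e., states x₀ for which there exists a system implementation f such that every play under f with x 0 = x₀ satisfies x n ∈ P for all n. Then W₀ ⊆ P and W₀ ⊆ Force¹ₛ(W₀). -/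
/-- The set `W₀` of winning states (states from which some system
implementation keeps every play safe) satisfies `W₀ ⊆ P` and
`W₀ ⊆ Force¹ₛ(W₀)`, assuming the transition relation is complete and the
type of uncontrollable inputs is nonempty. -/
theorem winning_states_subset_safe_and_force
    {X Inp C : Type*} [Nonempty Inp]
    (P : Set X) (T : X → Inp → C → X → Prop)
    (hcomplete : ∀ x i c, ∃ x', T x i c x')
    (W₀ : Set X)
    (hW₀ : W₀ = {x₀ | ∃ f : X × Inp → C,
      ∀ x : ℕ → X,
        (∀ n, ∃ i, T (x n) i (f (x n, i)) (x (n + 1))) →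
        x 0 = x₀ → ∀ n, x n ∈ P}) :
    W₀ ⊆ P ∧ W₀ ⊆ {x | ∀ i, ∃ c, ∃ x', T x i c x' ∧ x' ∈ W₀} := by
  subst hW₀
  choose s hs using hcomplete
  refine ⟨?_, ?_⟩
  · rintro x₀ ⟨f, hf⟩
    obtain ⟨i₀⟩ := ‹Nonempty Inp›
    let play : ℕ → X := fun n => Nat.rec x₀ (fun _ y => s y i₀ (f (y, i₀))) n
    exact hf play (fun n => ⟨i₀, hs _ _ _⟩) rfl 0
  · rintro x₀ ⟨f, hf⟩ i
    refine ⟨f (x₀, i), s x₀ i (f (x₀, i)), hs _ _ _, f, fun y hy hy₀ n => ?_⟩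
    let play : ℕ → X := fun n => Nat.casesOn n x₀ y
    refine hf play (fun m => ?_) rfl (n + 1)
    cases m with
    | zero =>
      refine ⟨i, ?_⟩
      change T x₀ i (f (x₀, i)) (y 0)
      rw [hy₀]
      exact hs _ _ _
    | succ m => exact hy m
end

section
/- Soundness of counterexample generalization in the QbfWin algorithm: let T be a transition relation over states X, uncontrollable inputs Inp, and controllable inputs C; let F, A, W ⊆ X. If W ⊆ F, W ⊆ Force¹ₛ(W), and no state of A ∩ F lies in Force¹ₛ(F), then W ⊆ F ∖ A; that is, removing the generalized counterexample region A from F removes no state of W. -/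
/-- Soundness of counterexample generalization in `QbfWin`: if `W ⊆ F`,
`W ⊆ Force¹ₛ(W)`, and no state of `A ∩ F` lies in `Force¹ₛ(F)`, then
`W ⊆ F ∖ A`. -/
theorem qbfwin_generalization_sound
    {X Inp C : Type*}
    (T : X → Inp → C → X → Prop)
    (F A W : Set X)
    (hWF : W ⊆ F)
    (hWforce : W ⊆ {x | ∀ i, ∃ c, ∃ x', T x i c x' ∧ x' ∈ W})
    (hA : ∀ x ∈ A ∩ F, x ∉ {x | ∀ i, ∃ c, ∃ x', T x i c x' ∧ x' ∈ F}) :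
    W ⊆ F \ A := by
  intro x hx
  refine ⟨hWF hx, fun hxA => hA x ⟨hxA, hWF hx⟩ fun i => ?_⟩
  obtain ⟨c, x', hT, hx'⟩ := hWforce hx i
  exact ⟨c, x', hT, hWF hx'⟩
end

section
/- Soundness of the reachability optimization RG (Theorem 3): let (X, I₀, Inp, C, T) be given, and let W, F, G ⊆ X with W ⊆ F and W ⊆ Force¹ₛ(W). Suppose there is no state x such that [x ∈ I₀, or there exist a state x* ∈ F ∖ G and values i*, c* with T(x*, i*, c*, x)] and x ∈ G ∩ F ∩ Force¹ₛ(F). Then there is no finite sequence of states x₀, x₁, …, x_n with x₀ ∈ I₀, x_j ∈ W for all j ≤ n, for each j < n some i and c with T(x_j, i, c, x_{j+1}), and x_n ∈ F ∩ G. In particular, F ∩ G contains no state that can enforce a visit to F in one step and is reachable along a play of states in W starting from an initial state. -/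
/-- Soundness of the reachability optimization RG (Theorem 3): let `W ⊆ F`
with `W ⊆ Force¹ₛ(W)`.  If no state `x` that is initial or has a predecessor
in `F ∖ G` lies in `G ∩ F ∩ Force¹ₛ(F)`, then no finite play through `W`
starting in an initial state ends in a state of `F ∩ G`. -/
theorem rg_optimization_sound
    {X Inp C : Type*}
    (I₀ : Set X) (T : X → Inp → C → X → Prop)
    (W F G : Set X)
    (hWF : W ⊆ F)
    (hWforce : W ⊆ {x | ∀ i, ∃ c, ∃ x', T x i c x' ∧ x' ∈ W})
    (hunsat : ¬ ∃ x : X,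
      (x ∈ I₀ ∨ ∃ (xs : X) (is : Inp) (cs : C),
        xs ∈ F ∧ xs ∉ G ∧ T xs is cs x) ∧
      x ∈ G ∧ x ∈ F ∧ x ∈ {x | ∀ i, ∃ c, ∃ x', T x i c x' ∧ x' ∈ F}) :
    ¬ ∃ (n : ℕ) (x : ℕ → X),
      x 0 ∈ I₀ ∧
      (∀ j ≤ n, x j ∈ W) ∧
      (∀ j < n, ∃ (i : Inp) (c : C), T (x j) i c (x (j + 1))) ∧
      x n ∈ F ∧ x n ∈ G := by
  rintro ⟨n, x, h0, hW, hT, -, hG⟩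
  have hforce : ∀ j ≤ n, ∀ i, ∃ c, ∃ x', T (x j) i c x' ∧ x' ∈ F := fun j hj i =>
    let ⟨c, x', hstep, hx'⟩ := hWforce (hW j hj) i
    ⟨c, x', hstep, hWF hx'⟩
  have avoid : ∀ j ≤ n, x j ∉ G := by
    intro j
    induction j with
    | zero =>
      intro hj hx
      exact hunsat ⟨x 0, Or.inl h0, hx, hWF (hW 0 hj), hforce 0 hj⟩
    | succ j ih =>
      intro hj hx
      obtain ⟨i, c, hstep⟩ := hT j hj
      have hj' : j ≤ n := Nat.le_of_succ_le hj
      exact hunsat ⟨x (j + 1), Or.inr ⟨x j, i, c, hWF (hW j hj'), ih hj', hstep⟩, hx,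
        hWF (hW (j + 1) hj), hforce (j + 1) hj⟩
  exact avoid n le_rfl hG
end
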